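/- Let N ≥ 1 and let (θ₀,μ) ↦ h*_{θ₀}(μ) be the family of convex conjugates of a family (h_{θ₀})_{θ₀>0}, where each h_{θ₀} : (0,∞)^N → ℝ is C², strictly convex, satisfies Hypothesis (H6a) and the uniform convexity bound (LMB21); assume the map (θ₀,μ) ↦ ∇h*_{θ₀}(μ) is continuous on (0,∞)×ℝ^N, and that for each θ₀ > 0: Σ_{i=1}^N ∂h*_{θ₀}/∂μ_i(λ𝟙) → 0 as λ → −∞ and Σ_{i=1}^N ∂h*_{θ₀}/∂μ_i(λ𝟙) → ∞ as λ → +∞, where 𝟙 = (1,…,1) ∈ ℝ^N. Let Ω ⊂ ℝ³ be a bounded measurable set with |Ω| > 0, let w ∈ L^∞(Ω), set θ(x) = e^{w(x)}, and let ρ̄₀ > 0. Then the algebraic equation ∫_Ω Σ_{i=1}^N ∂h*_{θ(x)}/∂μ_i(θ(x) q₀ 𝟙) dx = |Ω| ρ̄₀ has exactly one solution q₀ ∈ ℝ. -/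

import Mathlib

open Filter Topology MeasureTheory Matrix

noncomputable section

/-- The positive orthant `(0,∞)^N`. -/
def posOrth (N : ℕ) : Set (Fin N → ℝ) := {ρ | ∀ i, 0 < ρ i}

/-- Total density `ρ̄ = ∑ᵢ ρᵢ`. -/
def rbar {N : ℕ} (ρ : Fin N → ℝ) : ℝ := ∑ i, ρ i

/-- Gradient: the vector of partial derivatives. -/
def pgrad {N : ℕ} (h : (Fin N → ℝ) → ℝ) (ρ : Fin N → ℝ) : Fin N → ℝ :=
  fun i => fderiv ℝ h ρ (Pi.single i 1)

/-- Hessian matrix of second partial derivatives. -/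
def phess {N : ℕ} (h : (Fin N → ℝ) → ℝ) (ρ : Fin N → ℝ) : Matrix (Fin N) (Fin N) ℝ :=
  Matrix.of fun i j => fderiv ℝ (fun x => pgrad h x j) ρ (Pi.single i 1)

/-- Hypothesis (H6a): `h(ρ) → 0` and `∇h(ρ)·ρ → 0` as `ρ̄ → 0⁺`, `h(ρ)/ρ̄ → ∞` as
`ρ̄ → ∞`, and for each `i` and `R > 0`, `sup_{ρⱼ ∈ (0,R), j ≠ i} ∂h/∂ρᵢ(ρ) → -∞`
as `ρᵢ → 0⁺`. -/
def H6a {N : ℕ} (h : (Fin N → ℝ) → ℝ) : Prop :=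
  Tendsto h (𝓟 (posOrth N) ⊓ Filter.comap (rbar (N := N)) (𝓝[>] (0:ℝ))) (𝓝 0) ∧
  Tendsto (fun ρ : Fin N → ℝ => ∑ i, pgrad h ρ i * ρ i)
      (𝓟 (posOrth N) ⊓ Filter.comap (rbar (N := N)) (𝓝[>] (0:ℝ))) (𝓝 0) ∧
  Tendsto (fun ρ : Fin N → ℝ => h ρ / rbar ρ)
      (𝓟 (posOrth N) ⊓ Filter.comap (rbar (N := N)) atTop) atTop ∧
  ∀ i : Fin N, ∀ R > (0:ℝ), ∀ M : ℝ, ∃ ε > (0:ℝ), ∀ ρ ∈ posOrth N,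
    ρ i < ε → (∀ j, j ≠ i → ρ j < R) → pgrad h ρ i < M

/-- The convex conjugate (Legendre transform) `h*(μ) = sup_{ρ ∈ (0,∞)^N} (μ·ρ - h(ρ))`. -/
def hstar {N : ℕ} (h : (Fin N → ℝ) → ℝ) (μ : Fin N → ℝ) : ℝ :=
  sSup ((fun ρ => (∑ i, μ i * ρ i) - h ρ) '' posOrth N)

/-- The uniform convexity bound (LMB21): `∇²h(ρ)x·x ≥ (Kθ/ρ̄)|x|²`. -/
def LMB21 {N : ℕ} (h : (Fin N → ℝ) → ℝ) (θ K : ℝ) : Prop :=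
  ∀ ρ ∈ posOrth N, ∀ x : Fin N → ℝ,
    K * θ / rbar ρ * (∑ i, x i ^ 2) ≤ ∑ i, ∑ j, phess h ρ i j * x i * x j

/-- The continuous linear functional `ρ ↦ ∑ i, μ i * ρ i`. -/
def dotCLM {N : ℕ} (μ : Fin N → ℝ) : (Fin N → ℝ) →L[ℝ] ℝ :=
  ∑ i, μ i • ContinuousLinearMap.proj i

@[simp] lemma dotCLM_apply {N : ℕ} (μ ρ : Fin N → ℝ) : dotCLM μ ρ = ∑ i, μ i * ρ i := by
  simp [dotCLM]

lemma dotCLM_single {N : ℕ} (μ : Fin N → ℝ) (i : Fin N) : dotCLM μ (Pi.single i 1) = μ i := by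
  simp [Pi.single_apply]

lemma abs_dotCLM_le {N : ℕ} (μ ρ : Fin N → ℝ) : |dotCLM μ ρ| ≤ N * ‖μ‖ * ‖ρ‖ := by
  rw [dotCLM_apply]
  calc |∑ i, μ i * ρ i| ≤ ∑ i, |μ i * ρ i| := Finset.abs_sum_le_sum_abs _ _
    _ ≤ ∑ _i : Fin N, ‖μ‖ * ‖ρ‖ := by
        refine Finset.sum_le_sum fun i _ => ?_
        rw [abs_mul]
        exact mul_le_mul (norm_le_pi_norm μ i) (norm_le_pi_norm ρ i) (abs_nonneg _) (norm_nonneg _)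
    _ = N * ‖μ‖ * ‖ρ‖ := by simp [mul_assoc]

lemma isOpen_posOrth (N : ℕ) : IsOpen (posOrth N) := by
  have : posOrth N = Set.univ.pi fun _ : Fin N => Set.Ioi (0 : ℝ) := by
    ext ρ; simp [posOrth]
  rw [this]
  exact isOpen_set_pi Set.finite_univ fun _ _ => isOpen_Ioi

lemma StrictConvexOn.sub_dotCLM {N : ℕ} {h : (Fin N → ℝ) → ℝ}
    (hSC : StrictConvexOn ℝ (posOrth N) h) (μ : Fin N → ℝ) :
    StrictConvexOn ℝ (posOrth N) (fun ρ => h ρ - dotCLM μ ρ) :=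
  hSC.sub_concaveOn ((dotCLM μ).toLinearMap.concaveOn hSC.1)

lemma hstar_eq_of_isMinOn {N : ℕ} {h : (Fin N → ℝ) → ℝ} {μ ρ₀ : Fin N → ℝ}
    (hρ₀ : ρ₀ ∈ posOrth N) (hmin : IsMinOn (fun ρ => h ρ - dotCLM μ ρ) (posOrth N) ρ₀) :
    hstar h μ = dotCLM μ ρ₀ - h ρ₀ := by
  refine IsGreatest.csSup_eq ⟨⟨ρ₀, hρ₀, by simp⟩, ?_⟩
  rintro _ ⟨ρ, hρ, rfl⟩
  have := isMinOn_iff.1 hmin ρ hρ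
  simp only [dotCLM_apply] at this ⊢
  linarith

/-- Away from its minimizer, a strictly convex function grows at least linearly. -/
lemma StrictConvexOn.exists_linear_growth {N : ℕ} {f : (Fin N → ℝ) → ℝ} {s : Set (Fin N → ℝ)}
    (hf : StrictConvexOn ℝ s f) (hfc : ContinuousOn f s) {ρ₀ : Fin N → ℝ} (hρ₀ : ρ₀ ∈ s)
    (hmin : IsMinOn f s ρ₀) {r : ℝ} (hr : 0 < r) (hball : Metric.closedBall ρ₀ r ⊆ s) :
    ∃ κ > 0, ∀ ρ ∈ s, r ≤ ‖ρ - ρ₀‖ → f ρ₀ + κ * ‖ρ - ρ₀‖ ≤ f ρ := by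
  have hsub : Metric.sphere ρ₀ r ⊆ s := Metric.sphere_subset_closedBall.trans hball
  obtain ⟨δ, hδ, hδf⟩ : ∃ δ > 0, ∀ σ ∈ Metric.sphere ρ₀ r, f ρ₀ + δ ≤ f σ := by
    rcases (Metric.sphere ρ₀ r).eq_empty_or_nonempty with he | hne
    · exact ⟨1, one_pos, by simp [he]⟩
    obtain ⟨σ, hσ, hσmin⟩ := (isCompact_sphere ρ₀ r).exists_isMinOn hne (hfc.mono hsub)
    refine ⟨f σ - f ρ₀, ?_, fun τ hτ => by linarith [isMinOn_iff.1 hσmin τ hτ]⟩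
    have hle := isMinOn_iff.1 hmin σ (hsub hσ)
    refine sub_pos.2 (lt_of_le_of_ne hle fun heq => ?_)
    have hσ' : IsMinOn f s σ := isMinOn_iff.2 fun τ hτ => heq ▸ isMinOn_iff.1 hmin τ hτ
    have := hf.eq_of_isMinOn hmin hσ' hρ₀ (hsub hσ)
    rw [← this, Metric.mem_sphere, dist_self] at hσ
    exact hr.ne hσ
  refine ⟨δ / r, by positivity, fun ρ hρ hrρ => ?_⟩
  set d := ‖ρ - ρ₀‖ with hd
  have hdpos : 0 < d := hr.trans_le hrρ
  have ht1 : r / d ≤ 1 := (div_le_one hdpos).2 hrρ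
  have ht0 : 0 < r / d := by positivity
  have hσ : (1 - r / d) • ρ₀ + (r / d) • ρ ∈ Metric.sphere ρ₀ r := by
    have : (1 - r / d) • ρ₀ + (r / d) • ρ - ρ₀ = (r / d) • (ρ - ρ₀) := by module
    rw [mem_sphere_iff_norm, this, norm_smul, ← hd, Real.norm_of_nonneg ht0.le,
      div_mul_cancel₀ _ hdpos.ne']
  have h1 := hδf _ hσ
  have h2 := hf.convexOn.2 hρ₀ hρ (sub_nonneg.2 ht1) ht0.le (by ring)
  simp only [smul_eq_mul] at h2
  have h3 : δ ≤ r / d * (f ρ - f ρ₀) := by linarith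
  have h4 : δ / r * d ≤ f ρ - f ρ₀ := by
    have := mul_le_mul_of_nonneg_left h3 (by positivity : 0 ≤ d / r)
    calc δ / r * d = d / r * δ := by ring
      _ ≤ d / r * (r / d * (f ρ - f ρ₀)) := this
      _ = f ρ - f ρ₀ := by field_simp
  linarith

/-- The convex conjugate is differentiable wherever the supremum is attained, with the maximizer
as gradient. -/
lemma hasFDerivAt_hstar {N : ℕ} {h : (Fin N → ℝ) → ℝ} (hSC : StrictConvexOn ℝ (posOrth N) h)
    (hc : ContinuousOn h (posOrth N)) {μ ρ₀ : Fin N → ℝ} (hρ₀ : ρ₀ ∈ posOrth N)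
    (hmin : IsMinOn (fun ρ => h ρ - dotCLM μ ρ) (posOrth N) ρ₀) :
    HasFDerivAt (hstar h) (dotCLM ρ₀) μ := by
  rw [hasFDerivAt_iff_isLittleO_nhds_zero, Asymptotics.isLittleO_iff]
  intro c hcpos
  obtain ⟨r₀, hr₀, hball₀⟩ := Metric.nhds_basis_closedBall.mem_iff.1
    ((isOpen_posOrth N).mem_nhds hρ₀)
  set r := min r₀ (c / (N + 1)) with hrdef
  have hr : 0 < r := lt_min hr₀ (by positivity)
  have hNr : N * r ≤ c := by
    have h1 : r ≤ c / (N + 1) := min_le_right _ _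
    rw [le_div_iff₀ (by positivity)] at h1
    nlinarith
  obtain ⟨κ, hκ, hgrow⟩ := (hSC.sub_dotCLM μ).exists_linear_growth
    (hc.sub (dotCLM μ).continuous.continuousOn) hρ₀ hmin hr
    ((Metric.closedBall_subset_closedBall (min_le_left _ _)).trans hball₀)
  have hev : ∀ᶠ v : Fin N → ℝ in 𝓝 0, N * ‖v‖ ≤ κ := by
    have : Tendsto (fun v : Fin N → ℝ => N * ‖v‖) (𝓝 0) (𝓝 (N * ‖(0 : Fin N → ℝ)‖)) :=
      (continuous_const.mul continuous_norm).tendsto 0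
    rw [norm_zero, mul_zero] at this
    exact this.eventually_le_const hκ
  filter_upwards [hev] with v hv
  have hval := hstar_eq_of_isMinOn hρ₀ hmin
  have hsymm : dotCLM ρ₀ v = dotCLM v ρ₀ := by simp [mul_comm]
  have hadd : ∀ ρ, ∑ i, (μ + v) i * ρ i = dotCLM μ ρ + dotCLM v ρ := by
    intro ρ; simp [add_mul, Finset.sum_add_distrib]
  have hub : ∀ y ∈ (fun ρ => (∑ i, (μ + v) i * ρ i) - h ρ) '' posOrth N,
      y ≤ hstar h μ + dotCLM v ρ₀ + c * ‖v‖ := by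
    rintro _ ⟨ρ, hρ, rfl⟩
    simp only [hadd]
    have h1 := abs_le.1 (abs_dotCLM_le v (ρ - ρ₀))
    rw [map_sub] at h1
    have hcv : 0 ≤ c * ‖v‖ := by positivity
    rcases le_total r ‖ρ - ρ₀‖ with hfar | hnear
    · have h2 := hgrow ρ hρ hfar
      have h3 := mul_le_mul_of_nonneg_right hv (norm_nonneg (ρ - ρ₀))
      linarith [h1.2]
    · have h2 := isMinOn_iff.1 hmin ρ hρ
      have h3 : N * ‖v‖ * ‖ρ - ρ₀‖ ≤ c * ‖v‖ := by
        calc N * ‖v‖ * ‖ρ - ρ₀‖ ≤ N * ‖v‖ * r := by gcongr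
          _ = N * r * ‖v‖ := by ring
          _ ≤ c * ‖v‖ := by gcongr
      linarith [h1.2]
  have hle : hstar h (μ + v) ≤ hstar h μ + dotCLM v ρ₀ + c * ‖v‖ :=
    csSup_le (Set.Nonempty.image _ ⟨ρ₀, hρ₀⟩) hub
  have hge : dotCLM μ ρ₀ + dotCLM v ρ₀ - h ρ₀ ≤ hstar h (μ + v) :=
    le_csSup ⟨_, hub⟩ ⟨ρ₀, hρ₀, by simp only [hadd]⟩
  rw [hsymm, Real.norm_eq_abs, abs_le]
  have hcv : 0 ≤ c * ‖v‖ := by positivity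
  constructor <;> linarith

/-- First-order characterization of convexity on an open set. -/
lemma ConvexOn.add_fderiv_le {E : Type*} [NormedAddCommGroup E] [NormedSpace ℝ E] {s : Set E}
    {f : E → ℝ} (hf : ConvexOn ℝ s f) {x y : E} (hx : x ∈ s) (hy : y ∈ s)
    (hd : DifferentiableAt ℝ f x) : f x + fderiv ℝ f x (y - x) ≤ f y := by
  have hline : HasDerivAt (fun t : ℝ => f (x + t • (y - x))) (fderiv ℝ f x (y - x)) 0 :=
    hd.hasFDerivAt.hasLineDerivAt (y - x)
  have hle : fderiv ℝ f x (y - x) ≤ f y - f x := by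
    refine le_of_tendsto (hline.tendsto_slope_zero_right) ?_
    filter_upwards [Ioo_mem_nhdsGT (zero_lt_one' ℝ)] with t ht
    have h1 := hf.2 hx hy (sub_nonneg.2 ht.2.le) ht.1.le (by ring)
    have h2 : (1 - t) • x + t • y = x + t • (y - x) := by module
    rw [h2] at h1
    simp only [smul_eq_mul, zero_add, zero_smul, add_zero] at h1 ⊢
    rw [inv_mul_le_iff₀ ht.1]
    linarith
  linarith

/-- Raising small coordinates to the level `ε` does not increase a convex function whose partial
derivatives are nonpositive there. -/
lemma ConvexOn.le_of_raise_coords {N : ℕ} {f : (Fin N → ℝ) → ℝ}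
    (hf : ConvexOn ℝ (posOrth N) f) (hd : ∀ ρ ∈ posOrth N, DifferentiableAt ℝ f ρ) {ε R : ℝ}
    (hε : 0 < ε) (hεR : ε < R)
    (hneg : ∀ i, ∀ ρ ∈ posOrth N, ρ i = ε → (∀ j, ρ j < R) → fderiv ℝ f ρ (Pi.single i 1) ≤ 0)
    {ρ : Fin N → ℝ} (hρ : ρ ∈ posOrth N) (hρR : ∀ j, ρ j < R) :
    f (fun i => max (ρ i) ε) ≤ f ρ := by
  suffices H : ∀ s : Finset (Fin N), f (fun i => if i ∈ s then max (ρ i) ε else ρ i) ≤ f ρ by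
    simpa using H Finset.univ
  intro s
  induction s using Finset.induction_on with
  | empty => simp
  | insert i s hi ih =>
    refine le_trans ?_ ih
    set σ : Fin N → ℝ := fun j => if j ∈ s then max (ρ j) ε else ρ j with hσdef
    set τ : Fin N → ℝ := fun j => if j ∈ insert i s then max (ρ j) ε else ρ j with hτdef
    have hσ : σ ∈ posOrth N := by
      intro j; by_cases hj : j ∈ s <;> simp [hσdef, hj, hε, hρ j]
    have hτ : τ ∈ posOrth N := by
      intro j
      by_cases hj : j ∈ insert i s
      · simp only [hτdef, if_pos hj]; exact lt_max_of_lt_right hε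
      · simp only [hτdef, if_neg hj]; exact hρ j
    have hτR : ∀ j, τ j < R := by
      intro j
      by_cases hj : j ∈ insert i s
      · simp only [hτdef, if_pos hj]; exact max_lt (hρR j) hεR
      · simp only [hτdef, if_neg hj]; exact hρR j
    have hdiff : σ - τ = (ρ i - max (ρ i) ε) • (Pi.single i 1 : Fin N → ℝ) := by
      ext j
      by_cases hj : j = i
      · subst hj; simp [hσdef, hτdef, hi]
      · simp [hσdef, hτdef, hj]
    have hgrad := hf.add_fderiv_le hτ hσ (hd τ hτ)
    rw [hdiff, map_smul, smul_eq_mul] at hgrad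
    rcases le_total ε (ρ i) with hle | hle
    · rw [max_eq_left hle] at hgrad; linarith
    · rw [max_eq_right hle] at hgrad
      have hτi : τ i = ε := by simp [hτdef, hle]
      have := mul_nonneg_of_nonpos_of_nonpos (sub_nonpos.2 hle) (hneg i τ hτ hτi hτR)
      linarith

lemma exists_isMinOn_of_H6a {N : ℕ} {h : (Fin N → ℝ) → ℝ} (hSC : StrictConvexOn ℝ (posOrth N) h)
    (hd : ∀ ρ ∈ posOrth N, DifferentiableAt ℝ h ρ) (hH : H6a h) (μ : Fin N → ℝ) :
    ∃ ρ₀ ∈ posOrth N, IsMinOn (fun ρ => h ρ - dotCLM μ ρ) (posOrth N) ρ₀ := by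
  set f : (Fin N → ℝ) → ℝ := fun ρ => h ρ - dotCLM μ ρ with hf
  have hfd : ∀ ρ ∈ posOrth N, HasFDerivAt f (fderiv ℝ h ρ - dotCLM μ) ρ := fun ρ hρ =>
    (hd ρ hρ).hasFDerivAt.sub (dotCLM μ).hasFDerivAt
  have hfcont : ContinuousOn f (posOrth N) := fun ρ hρ =>
    (hfd ρ hρ).continuousAt.continuousWithinAt
  obtain ⟨-, -, hsuper, hedge⟩ := hH
  obtain ⟨R₀, hR₀⟩ : ∃ R₀, ∀ ρ ∈ posOrth N, R₀ ≤ rbar ρ → ‖μ‖ + 1 ≤ h ρ / rbar ρ := by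
    have := hsuper.eventually_ge_atTop (‖μ‖ + 1)
    rw [inf_comm, eventually_inf_principal, eventually_comap] at this
    obtain ⟨R₀, hR₀⟩ := eventually_atTop.1 this
    exact ⟨R₀, fun ρ hρ hle => hR₀ _ hle ρ rfl hρ⟩
  set R : ℝ := max R₀ (max (f fun _ => 1) 2) with hR
  have hR2 : 2 ≤ R := (le_max_right _ _).trans (le_max_right _ _)
  have hlarge : ∀ ρ ∈ posOrth N, R ≤ rbar ρ → f (fun _ => 1) ≤ f ρ := by
    intro ρ hρ hle
    have hpos : 0 < rbar ρ := by linarith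
    have h1 := hR₀ ρ hρ ((le_max_left _ _).trans hle)
    rw [le_div_iff₀ hpos] at h1
    have h2 : dotCLM μ ρ ≤ ‖μ‖ * rbar ρ := by
      rw [dotCLM_apply, rbar, Finset.mul_sum]
      exact Finset.sum_le_sum fun i _ => mul_le_mul_of_nonneg_right
        ((le_abs_self _).trans (norm_le_pi_norm μ i)) (hρ i).le
    have h3 : f (fun _ => 1) ≤ R := (le_max_left _ _).trans (le_max_right _ _)
    simp only [hf] at h3 ⊢
    linarith
  have hcoord : ∀ ρ ∈ posOrth N, rbar ρ < R → ∀ j, ρ j < R := fun ρ hρ hlt j =>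
    (Finset.single_le_sum (fun i _ => (hρ i).le) (Finset.mem_univ j)).trans_lt hlt
  choose! e he0 he using fun i => hedge i R (by linarith) (μ i)
  obtain ⟨ε, hε0, hε1, hεe⟩ : ∃ ε > 0, ε < 1 ∧ ∀ i, ε < e i := by
    have h1 : ∀ᶠ ε in 𝓝[>] (0 : ℝ), ∀ i, ε < e i := eventually_all.2 fun i =>
      nhdsWithin_le_nhds (eventually_lt_nhds (he0 i))
    have h2 : ∀ᶠ ε in 𝓝[>] (0 : ℝ), ε < 1 := nhdsWithin_le_nhds (eventually_lt_nhds one_pos)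
    obtain ⟨ε, h0, h1, h2⟩ := ((eventually_mem_nhdsWithin (a := (0 : ℝ))).and (h1.and h2)).exists
    exact ⟨ε, h0, h2, h1⟩
  have hbox : (Set.univ.pi fun _ : Fin N => Set.Icc ε R) ⊆ posOrth N := fun ρ hρ i =>
    hε0.trans_le (hρ i trivial).1
  have hone : (fun _ => 1 : Fin N → ℝ) ∈ Set.univ.pi fun _ : Fin N => Set.Icc ε R :=
    fun i _ => ⟨hε1.le, by linarith⟩
  obtain ⟨ρ₀, hρ₀, hmin⟩ := (isCompact_univ_pi fun _ : Fin N => isCompact_Icc).exists_isMinOn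
    ⟨_, hone⟩ (hfcont.mono hbox)
  refine ⟨ρ₀, hbox hρ₀, isMinOn_iff.2 fun ρ hρ => ?_⟩
  rcases le_or_gt R (rbar ρ) with hle | hlt
  · exact (isMinOn_iff.1 hmin _ hone).trans (hlarge ρ hρ hle)
  have hρR := hcoord ρ hρ hlt
  refine (isMinOn_iff.1 hmin (fun i => max (ρ i) ε) fun i _ =>
    ⟨le_max_right _ _, max_le (hρR i).le (by linarith)⟩).trans ?_
  refine (hSC.sub_dotCLM μ).convexOn.le_of_raise_coords
    (fun ρ hρ => (hfd ρ hρ).differentiableAt) hε0 (by linarith) ?_ hρ hρR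
  intro i σ hσ hσi hσR
  have h1 := he i σ hσ (hσi ▸ hεe i) fun j _ => hσR j
  rw [(hfd σ hσ).fderiv, _root_.sub_apply, dotCLM_single]
  exact (sub_neg.2 h1).le

/-- The total density conjugate to the chemical potential `lam • 𝟙` is strictly increasing. -/
lemma strictMono_sum_pgrad_hstar {N : ℕ} (hN : 1 ≤ N) {h : (Fin N → ℝ) → ℝ}
    (hC2 : ContDiffOn ℝ 2 h (posOrth N)) (hSC : StrictConvexOn ℝ (posOrth N) h) (hH : H6a h) :
    StrictMono fun lam : ℝ => ∑ i, pgrad (hstar h) (fun _ => lam) i := by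
  have hd : ∀ ρ ∈ posOrth N, DifferentiableAt ℝ h ρ := fun ρ hρ =>
    (hC2.differentiableOn (by norm_num)).differentiableAt ((isOpen_posOrth N).mem_nhds hρ)
  have hconst : ∀ (lam : ℝ) (ρ : Fin N → ℝ), dotCLM (fun _ => lam) ρ = lam * ∑ i, ρ i := by
    intro lam ρ; simp [Finset.mul_sum]
  have key : ∀ lam : ℝ, ∃ ρ ∈ posOrth N,
      IsMinOn (fun ρ => h ρ - dotCLM (fun _ => lam) ρ) (posOrth N) ρ ∧
      ∑ i, pgrad (hstar h) (fun _ => lam) i = ∑ i, ρ i := by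
    intro lam
    obtain ⟨ρ, hρ, hmin⟩ := exists_isMinOn_of_H6a hSC hd hH fun _ => lam
    refine ⟨ρ, hρ, hmin, Finset.sum_congr rfl fun i _ => ?_⟩
    rw [pgrad, (hasFDerivAt_hstar hSC hC2.continuousOn hρ hmin).fderiv, dotCLM_single]
  intro a b hab
  obtain ⟨ρ, hρ, hρmin, hρeq⟩ := key a
  obtain ⟨σ, hσ, hσmin, hσeq⟩ := key b
  simp only [hρeq, hσeq]
  have h1 := isMinOn_iff.1 hρmin σ hσ
  have h2 := isMinOn_iff.1 hσmin ρ hρ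
  simp only [hconst] at h1 h2
  have hle : ∑ i, ρ i ≤ ∑ i, σ i := by
    by_contra! hlt
    nlinarith
  refine lt_of_le_of_ne hle fun heq => ?_
  have hval : h ρ = h σ := by rw [heq] at h1 h2; linarith
  have hσmin' : IsMinOn (fun ρ => h ρ - dotCLM (fun _ => a) ρ) (posOrth N) σ := by
    refine isMinOn_iff.2 fun τ hτ => ?_
    have := isMinOn_iff.1 hρmin τ hτ
    simp only [hconst] at this ⊢
    rwa [← hval, ← heq]
  obtain rfl := (hSC.sub_dotCLM _).eq_of_isMinOn hρmin hσmin' hρ hσ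
  have hcrit : ∀ lam : ℝ, IsMinOn (fun ρ => h ρ - dotCLM (fun _ => lam) ρ) (posOrth N) ρ →
      fderiv ℝ h ρ = dotCLM fun _ => lam := fun lam hmin =>
    sub_eq_zero.1 ((hmin.isLocalMin ((isOpen_posOrth N).mem_nhds hρ)).hasFDerivAt_eq_zero
      ((hd ρ hρ).hasFDerivAt.sub (dotCLM _).hasFDerivAt))
  have hab' := congrArg (fun L => L (Pi.single (⟨0, hN⟩ : Fin N) 1))
    ((hcrit a hρmin).symm.trans (hcrit b hσmin))
  simp only [dotCLM_single] at hab'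
  exact hab.ne hab'

/-- If `G` is jointly continuous, and each `G t` is monotone and exceeds `c` somewhere, then
all `G t` with `t` in a compact set exceed `c` at a common point. -/
lemma IsCompact.exists_forall_lt_of_monotone {X : Type*} [TopologicalSpace X] {S : Set X}
    (hS : IsCompact S) {G : X → ℝ → ℝ} (hG : Continuous (Function.uncurry G))
    (hmono : ∀ t, Monotone (G t)) {c : ℝ} (hlim : ∀ t ∈ S, ∃ q, c < G t q) :
    ∃ q, ∀ t ∈ S, c < G t q := by
  refine hS.induction_on (p := fun T => ∃ q, ∀ t ∈ T, c < G t q) ⟨0, by simp⟩ ?_ ?_ ?_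
  · rintro T U hTU ⟨q, hq⟩
    exact ⟨q, fun t ht => hq t (hTU ht)⟩
  · rintro T U ⟨p, hp⟩ ⟨q, hq⟩
    refine ⟨max p q, ?_⟩
    rintro t (ht | ht)
    · exact (hp t ht).trans_le (hmono t (le_max_left _ _))
    · exact (hq t ht).trans_le (hmono t (le_max_right _ _))
  · intro t ht
    obtain ⟨q, hq⟩ := hlim t ht
    have hGq : Continuous fun s => G s q := hG.comp (by fun_prop : Continuous fun s => (s, q))
    exact ⟨_, mem_nhdsWithin_of_mem_nhds (hGq.continuousAt.eventually (lt_mem_nhds hq)),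
      q, fun s hs => hs⟩

lemma existsUnique_setIntegral_eq {α : Type*} [MeasurableSpace α] {ν : Measure α} {Ω : Set α}
    (hΩm : MeasurableSet Ω) (hΩpos : ν Ω ≠ 0) (hΩfin : ν Ω ≠ ⊤) {w : α → ℝ} (hw : Measurable w)
    {C : ℝ} (hC : ∀ x ∈ Ω, |w x| ≤ C) {G : ℝ → ℝ → ℝ} (hG : Continuous (Function.uncurry G))
    (hmono : ∀ t, StrictMono (G t)) {c : ℝ} (hbot : ∀ t, ∃ q, G t q < c)
    (htop : ∀ t, ∃ q, c < G t q) :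
    ∃! q : ℝ, ∫ x in Ω, G (w x) q ∂ν = (ν Ω).toReal * c := by
  have hwC : ∀ x ∈ Ω, w x ∈ Set.Icc (-C) C := fun x hx => abs_le.1 (hC x hx)
  have : Fact (ν Ω < ⊤) := ⟨hΩfin.lt_top⟩
  have hmeas : ∀ q, AEStronglyMeasurable (fun x => G (w x) q) (ν.restrict Ω) := fun q =>
    ((hG.comp (by fun_prop : Continuous fun s : ℝ => (s, q))).measurable.comp
      hw).aestronglyMeasurable
  have hbound : ∀ q : ℝ, ∃ B, ∀ t ∈ Set.Icc (-C) C, ∀ p ∈ Metric.closedBall q 1, ‖G t p‖ ≤ B := by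
    intro q
    obtain ⟨B, hB⟩ := ((isCompact_Icc (a := -C) (b := C)).prod
      (isCompact_closedBall q 1)).exists_bound_of_continuousOn hG.continuousOn
    exact ⟨B, fun t ht p hp => hB (t, p) ⟨ht, hp⟩⟩
  have hint : ∀ q, Integrable (fun x => G (w x) q) (ν.restrict Ω) := by
    intro q
    obtain ⟨B, hB⟩ := hbound q
    refine Integrable.of_bound (hmeas q) B ?_
    exact ae_restrict_of_forall_mem hΩm fun x hx =>
      hB _ (hwC x hx) q (Metric.mem_closedBall_self zero_le_one)
  have hF : Continuous fun q => ∫ x in Ω, G (w x) q ∂ν := by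
    refine continuous_iff_continuousAt.2 fun q => ?_
    obtain ⟨B, hB⟩ := hbound q
    refine continuousAt_of_dominated (bound := fun _ => B) (Eventually.of_forall hmeas) ?_
      (integrable_const B) ?_
    · filter_upwards [Metric.closedBall_mem_nhds q one_pos] with p hp
      exact ae_restrict_of_forall_mem hΩm fun x hx => hB _ (hwC x hx) p hp
    · exact Eventually.of_forall fun x =>
        (hG.comp (by fun_prop : Continuous fun p : ℝ => (w x, p))).continuousAt
  have hFmono : StrictMono fun q => ∫ x in Ω, G (w x) q ∂ν := by
    intro p q hpq
    have hle : ∀ᵐ x ∂ν.restrict Ω, G (w x) p ≤ G (w x) q :=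
      Eventually.of_forall fun x => (hmono _ hpq).le
    refine lt_of_le_of_ne (integral_mono_ae (hint p) (hint q) hle) fun heq => hΩpos ?_
    have hae := (integral_eq_iff_of_ae_le (hint p) (hint q) hle).1 heq
    have hfalse : ∀ᵐ _ ∂ν.restrict Ω, False := hae.mono fun x hx => (hmono _ hpq).ne hx
    rwa [eventually_false_iff_eq_bot, ae_eq_bot, Measure.restrict_eq_zero] at hfalse
  have hconst : ∫ _ in Ω, c ∂ν = (ν Ω).toReal * c := by simp [Measure.real]
  obtain ⟨q₁, hq₁⟩ := (isCompact_Icc (a := -C) (b := C)).exists_forall_lt_of_monotone hG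
    (fun t => (hmono t).monotone) fun t _ => htop t
  obtain ⟨q₀, hq₀⟩ := (isCompact_Icc (a := -C) (b := C)).exists_forall_lt_of_monotone
    (G := fun t q => -G t (-q)) (c := -c)
    (hG.comp (by fun_prop : Continuous fun z : ℝ × ℝ => (z.1, -z.2))).neg
    (fun t p q hpq => neg_le_neg ((hmono t).monotone (neg_le_neg hpq)))
    fun t _ => (hbot t).imp' Neg.neg fun q hq => by simpa using hq
  have hlow : ∫ x in Ω, G (w x) (-q₀) ∂ν ≤ (ν Ω).toReal * c := by
    rw [← hconst]
    exact setIntegral_mono_on (hint _) (integrable_const c) hΩm fun x hx =>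
      (neg_lt_neg_iff.1 (hq₀ _ (hwC x hx))).le
  have hhigh : (ν Ω).toReal * c ≤ ∫ x in Ω, G (w x) q₁ ∂ν := by
    rw [← hconst]
    exact setIntegral_mono_on (integrable_const c) (hint _) hΩm fun x hx => (hq₁ _ (hwC x hx)).le
  obtain ⟨q, hq⟩ := mem_range_of_exists_le_of_exists_ge hF ⟨_, hlow⟩ ⟨_, hhigh⟩
  exact ⟨q, hq, fun p hp => hFmono.injective (hp.trans hq.symm)⟩

/-- For a family of free energies `h_{θ₀}` (C², strictly convex,
(H6a), (LMB21)) whose conjugates have continuous gradient in `(θ₀,μ)` and satisfy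
`∑ᵢ ∂h*_{θ₀}/∂μᵢ(λ𝟙) → 0` as `λ → -∞` and `→ ∞` as `λ → ∞`, for any bounded
measurable `Ω ⊂ ℝ³` of positive measure, `w ∈ L^∞(Ω)`, `θ = e^w`, and `ρ̄₀ > 0`,
the equation `∫_Ω ∑ᵢ ∂h*_{θ(x)}/∂μᵢ(θ(x) q₀ 𝟙) dx = |Ω| ρ̄₀` has exactly one
solution `q₀ ∈ ℝ`. -/
theorem stmt8 (N : ℕ) (hN : 1 ≤ N) (K : ℝ) (hK : 0 < K)
    (h : ℝ → (Fin N → ℝ) → ℝ)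
    (hC2 : ∀ θ₀ > (0:ℝ), ContDiffOn ℝ 2 (h θ₀) (posOrth N))
    (hSC : ∀ θ₀ > (0:ℝ), StrictConvexOn ℝ (posOrth N) (h θ₀))
    (hH6 : ∀ θ₀ > (0:ℝ), H6a (h θ₀))
    (hLMB : ∀ θ₀ > (0:ℝ), LMB21 (h θ₀) θ₀ K)
    (hcont : ContinuousOn (fun p : ℝ × (Fin N → ℝ) => pgrad (hstar (h p.1)) p.2)
      (Set.Ioi (0:ℝ) ×ˢ (Set.univ : Set (Fin N → ℝ))))
    (hbot : ∀ θ₀ > (0:ℝ),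
      Tendsto (fun lam : ℝ => ∑ i, pgrad (hstar (h θ₀)) (fun _ => lam) i) atBot (𝓝 0))
    (htop : ∀ θ₀ > (0:ℝ),
      Tendsto (fun lam : ℝ => ∑ i, pgrad (hstar (h θ₀)) (fun _ => lam) i) atTop atTop)
    (Ω : Set (Fin 3 → ℝ)) (hΩb : Bornology.IsBounded Ω) (hΩm : MeasurableSet Ω)
    (hΩpos : 0 < volume Ω)
    (w : (Fin 3 → ℝ) → ℝ) (hw : Measurable w) (hwb : ∃ C : ℝ, ∀ x ∈ Ω, |w x| ≤ C)
    (ρ0 : ℝ) (hρ0 : 0 < ρ0) :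
    ∃! q0 : ℝ,
      (∫ x in Ω, ∑ i, pgrad (hstar (h (Real.exp (w x)))) (fun _ => Real.exp (w x) * q0) i)
        = (volume Ω).toReal * ρ0 := by
  obtain ⟨C, hC⟩ := hwb
  have hcomp : Continuous fun z : ℝ × ℝ =>
      pgrad (hstar (h (Real.exp z.1))) (fun _ => Real.exp z.1 * z.2) :=
    hcont.comp_continuous (f := fun z : ℝ × ℝ =>
      (Real.exp z.1, (fun _ => Real.exp z.1 * z.2 : Fin N → ℝ))) (by fun_prop)
      fun z => ⟨Real.exp_pos _, trivial⟩
  refine existsUnique_setIntegral_eq hΩm hΩpos.ne' hΩb.measure_lt_top.ne hw hC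
    (G := fun t q => ∑ i, pgrad (hstar (h (Real.exp t))) (fun _ => Real.exp t * q) i)
    (continuous_finsetSum _ fun i _ => (continuous_apply i).comp hcomp) ?_ ?_ ?_
  · intro t p q hpq
    have ht := Real.exp_pos t
    exact strictMono_sum_pgrad_hstar hN (hC2 _ ht) (hSC _ ht) (hH6 _ ht)
      (mul_lt_mul_of_pos_left hpq ht)
  · intro t
    have ht := Real.exp_pos t
    exact (((hbot _ ht).comp (tendsto_id.const_mul_atBot ht)).eventually_lt_const hρ0).exists
  · intro t
    have ht := Real.exp_pos t
    exact (((htop _ ht).comp (tendsto_id.const_mul_atTop ht)).eventually_gt_atTop ρ0).exists
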